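/- arXiv:1401.6040 — 2 statements merged into one kernel-verified Lean document; each statement's English description precedes it below -/
import Mathlib

section
/- Let f be an isoarithmetic IASI with common difference d of a finite simple graph G, let v be a vertex of G of degree 2, and let u, w be its two neighbors, assumed non-adjacent in G. Let G' be the graph on V(G)∖{v} in which x, y are adjacent iff they are adjacent in G or {x,y} = {u,w} (an elementary topological reduction of G). Then the restriction of f to V(G)∖{v} is injective, and every vertex label and every edge label of G' under this labeling is a d-AP-set. -/
open Pointwise

/-- A finite set of naturals is a `d`-AP-set if `d > 0`, it has at least 3 elements,
and its elements form an arithmetic progression with common difference `d`. -/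
def IsAPSet (d : ℕ) (A : Finset ℕ) : Prop :=
  0 < d ∧ 3 ≤ A.card ∧ ∃ a : ℕ, A = (Finset.range A.card).image (fun i => a + i * d)

/-- An integer additive set-indexer (IASI) of a simple graph `G`: an injective labeling of
vertices by nonempty finite sets of naturals whose induced edge labeling
`f⁺(uv) = f(u) + f(v)` (sumset) is injective on edges. -/
structure IsIASI {V : Type*} (G : SimpleGraph V) (f : V → Finset ℕ) : Prop where
  injective : Function.Injective f
  nonempty : ∀ v, (f v).Nonempty
  edgeInjective : ∀ ⦃u v x y : V⦄, G.Adj u v → G.Adj x y →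
    f u + f v = f x + f y → s(u, v) = s(x, y)

/-- An isoarithmetic IASI of `G` with common difference `d`: an IASI all of whose vertex
and edge labels are `d`-AP-sets. -/
def IsIsoarithmeticIASI {V : Type*} (G : SimpleGraph V) (f : V → Finset ℕ) (d : ℕ) : Prop :=
  IsIASI G f ∧ (∀ v, IsAPSet d (f v)) ∧ (∀ u v, G.Adj u v → IsAPSet d (f u + f v))

theorem image_range_add_image_range (a b d : ℕ) {m n : ℕ} (hm : 0 < m) (hn : 0 < n) :
    (Finset.range m).image (fun i => a + i * d) + (Finset.range n).image (fun i => b + i * d) =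
      (Finset.range (m + n - 1)).image (fun i => a + b + i * d) := by
  ext x
  simp only [Finset.mem_add, Finset.mem_image, Finset.mem_range]
  constructor
  · rintro ⟨_, ⟨i, hi, rfl⟩, _, ⟨j, hj, rfl⟩, rfl⟩
    exact ⟨i + j, by omega, by ring⟩
  · rintro ⟨k, hk, rfl⟩
    refine ⟨_, ⟨min k (m - 1), by omega, rfl⟩, _, ⟨k - min k (m - 1), by omega, rfl⟩, ?_⟩
    have hk' : k = min k (m - 1) + (k - min k (m - 1)) := by omega
    conv_rhs => rw [hk']
    ring

theorem isAPSet_image_range {d : ℕ} (hd : 0 < d) (a : ℕ) {n : ℕ} (hn : 3 ≤ n) :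
    IsAPSet d ((Finset.range n).image (fun i => a + i * d)) := by
  have hinj : Function.Injective (fun i => a + i * d) := fun i j hij =>
    Nat.eq_of_mul_eq_mul_right hd (Nat.add_left_cancel hij)
  have hcard : ((Finset.range n).image (fun i => a + i * d)).card = n := by
    rw [Finset.card_image_of_injective _ hinj, Finset.card_range]
  exact ⟨hd, by rwa [hcard], a, by rw [hcard]⟩

theorem IsAPSet.add {d : ℕ} {A B : Finset ℕ} (hA : IsAPSet d A) (hB : IsAPSet d B) :
    IsAPSet d (A + B) := by
  obtain ⟨hd, hA₃, a, hA⟩ := hA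
  obtain ⟨-, hB₃, b, hB⟩ := hB
  rw [hA, hB, image_range_add_image_range a b d (by omega) (by omega)]
  exact isAPSet_image_range hd _ (by omega)

/-- Elementary topological reduction of an isoarithmetic IASI graph: if `v` has exactly
the two non-adjacent neighbours `u` and `w`, then on the reduced graph `G'`
(obtained by deleting `v` and joining `u` to `w`), the restriction of `f` is injective and
all vertex and edge labels are `d`-AP-sets. -/
theorem stmt5 {V : Type*} [Fintype V] (G : SimpleGraph V)
    (f : V → Finset ℕ) (d : ℕ) (h : IsIsoarithmeticIASI G f d)
    (v u w : V) (hn : G.neighborSet v = {u, w}) (huw : u ≠ w) (hnadj : ¬ G.Adj u w) :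
    (∀ x y, x ≠ v → y ≠ v → f x = f y → x = y) ∧
    (∀ x, x ≠ v → IsAPSet d (f x)) ∧
    (∀ x y, x ≠ v → y ≠ v →
      (G.Adj x y ∨ (x = u ∧ y = w) ∨ (x = w ∧ y = u)) →
      IsAPSet d (f x + f y)) := by
  exact ⟨fun _ _ _ _ hxy => h.1.injective hxy, fun x _ => h.2.1 x,
    fun x y _ _ _ => (h.2.1 x).add (h.2.1 y)⟩
end

section
/- Let G be a finite simple graph, let f label the vertices of G by AP-sets (f(v) a d_v-AP-set), and suppose some edge uv of G satisfies d_v = k·d_u for an integer k > |f(u)|. Then the edge label f⁺(uv) = f(u)+f(v) is not an AP-set; consequently, the induced labeling of the line graph L(G) by e ↦ f⁺(e) assigns a non-AP-set to the vertex of L(G) corresponding to uv, so this labeling is not an arithmetic labeling of L(G) (not all of its vertex labels are AP-sets). -/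
open Pointwise

/-- The elements of a `d`-AP-set are exactly `a + i * d` for `i` below its cardinality. -/
lemma IsAPSet.exists_mem_iff {d : ℕ} {A : Finset ℕ} (h : IsAPSet d A) :
    ∃ a, ∀ x, x ∈ A ↔ ∃ i < A.card, a + i * d = x := by
  obtain ⟨-, -, a, ha⟩ := h
  refine ⟨a, fun x => ?_⟩
  conv_lhs => rw [ha]
  simp

/-- The sum of a `d`-AP-set `A` and a `k * d`-AP-set with `|A| < k` is not an AP-set. -/
lemma IsAPSet.not_isAPSet_add {d k : ℕ} {A B : Finset ℕ} (hA : IsAPSet d A)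
    (hB : IsAPSet (k * d) B) (hk : A.card < k) (δ : ℕ) : ¬ IsAPSet δ (A + B) := by
  intro hS
  obtain ⟨a, ha⟩ := hA.exists_mem_iff
  obtain ⟨b, hb⟩ := hB.exists_mem_iff
  obtain ⟨c, hc⟩ := hS.exists_mem_iff
  obtain ⟨hd, hA3, -⟩ := hA
  obtain ⟨-, hB3, -⟩ := hB
  obtain ⟨hδ, hS3, -⟩ := hS
  have hmem (x : ℕ) :
      x ∈ A + B ↔ ∃ i < A.card, ∃ j < B.card, x = a + b + (i + j * k) * d := by
    rw [Finset.mem_add]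
    constructor
    · rintro ⟨y, hy, z, hz, rfl⟩
      obtain ⟨i, hi, rfl⟩ := (ha y).1 hy
      obtain ⟨j, hj, rfl⟩ := (hb z).1 hz
      exact ⟨i, hi, j, hj, by ring⟩
    · rintro ⟨i, hi, j, hj, rfl⟩
      exact ⟨_, (ha _).2 ⟨i, hi, rfl⟩, _, (hb _).2 ⟨j, hj, rfl⟩, by ring⟩
  have hc_eq : c = a + b := by
    obtain ⟨i, -, h⟩ := (hc _).1 ((hmem (a + b)).2 ⟨0, by lia, 0, by lia, by simp⟩)
    obtain ⟨i', -, j', -, h'⟩ := (hmem c).1 ((hc c).2 ⟨0, by lia, by simp⟩)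
    exact le_antisymm (h ▸ Nat.le_add_right _ _) (h' ▸ Nat.le_add_right _ _)
  subst hc_eq
  have hδd : δ = d := by
    obtain ⟨i, -, h⟩ := (hc _).1 ((hmem (a + b + d)).2 ⟨1, by lia, 0, by lia, by simp⟩)
    obtain ⟨i', -, j', -, h'⟩ := (hmem (a + b + δ)).1 ((hc _).2 ⟨1, by lia, by simp⟩)
    exact Nat.dvd_antisymm (Dvd.intro_left i (by lia)) (Dvd.intro_left (i' + j' * k) (by lia))
  subst hδd
  obtain ⟨t, ht, h⟩ :=
    (hc _).1 ((hmem (a + b + k * δ)).2 ⟨0, by lia, 1, by lia, by simp⟩)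
  have htk : t = k := Nat.eq_of_mul_eq_mul_right hd (by lia)
  obtain ⟨i, hi, j, -, h'⟩ :=
    (hmem (a + b + A.card * δ)).1 ((hc _).2 ⟨A.card, by lia, rfl⟩)
  have hij : A.card = i + j * k := Nat.eq_of_mul_eq_mul_right hd (by lia)
  rcases Nat.eq_zero_or_pos j with rfl | hj
  · lia
  · have := Nat.le_mul_of_pos_left k hj
    lia

/-- If `f` labels the vertices of `G` by AP-sets and some edge `uv` satisfies
`d_v = k · d_u` with `k > |f(u)|`, then the edge label `f⁺(uv)` is not an AP-set; hence
the induced vertex labeling of the line graph `L(G)` is not an arithmetic labeling. -/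
theorem stmt14 {V : Type*} [Fintype V] (G : SimpleGraph V)
    (f : V → Finset ℕ) (dv : V → ℕ) (hAP : ∀ v, IsAPSet (dv v) (f v))
    (u v : V) (huv : G.Adj u v) (k : ℕ) (hkd : dv v = k * dv u)
    (hk : (f u).card < k) :
    (¬ ∃ δ, IsAPSet δ (f u + f v)) ∧
    ¬ (∀ a b, G.Adj a b → ∃ δ, IsAPSet δ (f a + f b)) := by
  have h : ¬ ∃ δ, IsAPSet δ (f u + f v) := fun ⟨δ, hδ⟩ =>
    (hAP u).not_isAPSet_add (hkd ▸ hAP v) hk δ hδ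
  exact ⟨h, fun H => h (H u v huv)⟩
end
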